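/- Let (I, A) be a pair with A ∈ ℝ^{n×n} Hurwitz, and B ∈ ℝ^{n×m}, γ > 0. If ‖(sI − A)^{−1}B‖_{H∞} < 1/γ then there exists a symmetric positive definite X solving A X + X Aᵀ + γ² X X + B Bᵀ = 0. -/

import Mathlib

open Matrix

/-- The spectral (ℓ²→ℓ²) operator norm of a complex matrix. -/
noncomputable def specNorm {m n : Type*} [Fintype m] [Fintype n] [DecidableEq n]
    (B : Matrix m n ℂ) : ℝ :=
  ‖LinearMap.toContinuousLinearMap (Matrix.toEuclideanLin B)‖

/-- The H∞ norm of a (stable) matrix-valued transfer function `K`,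
`‖K‖_{H∞} = sup_{ω ∈ ℝ} ‖K(jω)‖₂`. -/
noncomputable def hinfNorm {m n : Type*} [Fintype m] [Fintype n] [DecidableEq n]
    (K : ℝ → Matrix m n ℂ) : ℝ :=
  ⨆ ω : ℝ, specNorm (K ω)

/-- A real square matrix is Hurwitz if all of its (complex) eigenvalues have
negative real part. -/
def IsHurwitz {m : Type*} [Fintype m] [DecidableEq m] (A : Matrix m m ℝ) : Prop :=
  ∀ μ ∈ spectrum ℂ (A.map (algebraMap ℝ ℂ)), μ.re < 0

open Polynomial in
/-- A real polynomial without purely imaginary roots splits into a factor with roots in the open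
left half-plane and one with roots in the open right half-plane. -/
theorem exists_eq_mul_of_forall_root_re_ne_zero (f : ℝ[X]) (hf : f ≠ 0)
    (h : ∀ z : ℂ, aeval z f = 0 → z.re ≠ 0) :
    ∃ p q : ℝ[X], f = p * q ∧ (∀ z : ℂ, aeval z p = 0 → z.re < 0) ∧
      ∀ z : ℂ, aeval z q = 0 → 0 < z.re := by
  induction f using WfDvdMonoid.induction_on_irreducible with
  | zero => exact absurd rfl hf
  | unit u hu =>
    have hu' (z : ℂ) : aeval z u ≠ 0 := (hu.map (aeval z)).ne_zero
    exact ⟨u, 1, by simp, fun z hz => absurd hz (hu' z), fun z hz => by simp at hz⟩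
  | mul a i ha hi ih =>
    obtain ⟨p, q, rfl, hp, hq⟩ := ih ha fun z hz => h z (by simp [hz])
    have key (z w : ℂ) (hz : aeval z i = 0) (hw : aeval w i = 0) : z.re = w.re := by
      let r : ℝ[X] := X ^ 2 - C (2 * z.re) * X + C (Complex.normSq z)
      have hr (x : ℂ) : aeval x r = (x - z) * (x - (starRingEnd ℂ) z) := by
        have h1 := Complex.mul_conj z
        have h2 := Complex.add_conj z
        simp only [r, map_add, map_sub, map_mul, map_pow, aeval_X, aeval_C,
          Complex.coe_algebraMap]
        push_cast at h2 ⊢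
        linear_combination x * h2 - h1
      have hdvd : i ∣ r := by
        by_contra hnd
        have hc := (hi.coprime_iff_not_dvd).2 hnd
        rcases aeval_ne_zero_of_isCoprime hc z with h1 | h1
        · exact h1 hz
        · exact h1 (by simp [hr])
      obtain ⟨s, hs⟩ := hdvd
      have hwr : (w - z) * (w - (starRingEnd ℂ) z) = 0 := by
        rw [← hr, hs]; simp [hw]
      rcases mul_eq_zero.1 hwr with h1 | h1
      · rw [sub_eq_zero.1 h1]
      · rw [sub_eq_zero.1 h1]; simp
    by_cases hneg : ∃ z : ℂ, aeval z i = 0 ∧ z.re < 0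
    · obtain ⟨z, hz, hz0⟩ := hneg
      refine ⟨i * p, q, by ring, fun w hw => ?_, hq⟩
      rw [map_mul, mul_eq_zero] at hw
      rcases hw with hw | hw
      · rwa [← key z w hz hw]
      · exact hp w hw
    · push Not at hneg
      refine ⟨p, i * q, by ring, hp, fun w hw => ?_⟩
      rw [map_mul, mul_eq_zero] at hw
      rcases hw with hw | hw
      · exact lt_of_le_of_ne (hneg w hw) (h w (by simp [hw])).symm
      · exact hq w hw

open Polynomial in
theorem isCoprime_of_root_re_neg_of_root_re_pos {p q : ℝ[X]}
    (hp : ∀ z : ℂ, aeval z p = 0 → z.re < 0) (hq : ∀ z : ℂ, aeval z q = 0 → 0 < z.re) :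
    IsCoprime p q := by
  refine (Polynomial.isCoprime_iff_aeval_ne_zero_of_isAlgClosed (k := ℝ) ℂ p q).2 fun z => ?_
  by_contra! hz
  exact lt_asymm (hp z hz.1) (hq z hz.2)

open Polynomial in
theorem root_comp_neg_X_re_pos {p : ℝ[X]} (hp : ∀ z : ℂ, aeval z p = 0 → z.re < 0) (z : ℂ)
    (hz : aeval z (p.comp (-X)) = 0) : 0 < z.re := by
  have := hp (-z) (by simpa [aeval_comp] using hz)
  simpa using this

open Polynomial in
theorem root_comp_neg_X_re_neg {p : ℝ[X]} (hp : ∀ z : ℂ, aeval z p = 0 → 0 < z.re) (z : ℂ)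
    (hz : aeval z (p.comp (-X)) = 0) : z.re < 0 := by
  have := hp (-z) (by simpa [aeval_comp] using hz)
  simpa using this

open Polynomial in
/-- If `φ` intertwines `g` and `f` on a `g`-invariant submodule, it intertwines all polynomials. -/
theorem aeval_apply_eq_of_intertwines {K U V : Type*} [Field K] [AddCommGroup U] [Module K U]
    [AddCommGroup V] [Module K V] {f : Module.End K V} {g : Module.End K U} (φ : U →ₗ[K] V)
    (S : Submodule K U) (hS : ∀ u ∈ S, g u ∈ S) (h : ∀ u ∈ S, f (φ u) = φ (g u))
    (p : K[X]) (u : U) (hu : u ∈ S) : aeval f p (φ u) = φ (aeval g p u) := by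
  induction p using Polynomial.induction_on generalizing u with
  | C a => simp [aeval_C, Module.algebraMap_end_apply]
  | add p q hp hq => simp [hp u hu, hq u hu]
  | monomial n a ih =>
    rw [pow_succ, ← mul_assoc, map_mul _ _ X, map_mul _ _ X, aeval_X, aeval_X,
      Module.End.mul_apply, Module.End.mul_apply, h u hu, ih _ (hS u hu)]

open Polynomial in
theorem aeval_charpoly_eq_zero_iff {ι : Type*} [Fintype ι] [DecidableEq ι] (M : Matrix ι ι ℝ)
    (z : ℂ) : aeval z M.charpoly = 0 ↔ z ∈ spectrum ℂ (M.map (algebraMap ℝ ℂ)) := by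
  rw [Matrix.mem_spectrum_iff_isRoot_charpoly, Polynomial.IsRoot.def, Matrix.charpoly_map,
    Polynomial.eval_map_algebraMap]

open Polynomial in
theorem aeval_toLin'_charpoly {ι : Type*} [Fintype ι] [DecidableEq ι] (M : Matrix ι ι ℝ) :
    aeval (Matrix.toLin' M) M.charpoly = 0 := by
  have := LinearMap.aeval_self_charpoly (Matrix.toLin' M)
  rwa [Matrix.charpoly_toLin'] at this

open Polynomial in
theorem bilin_aeval_apply {K V : Type*} [Field K] [AddCommGroup V] [Module K V]
    (ω : V →ₗ[K] V →ₗ[K] K) (H : Module.End K V) (hω : ∀ u v, ω (H u) v = -ω u (H v))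
    (p : K[X]) (u v : V) : ω (aeval H p u) v = ω u (aeval H (p.comp (-X)) v) := by
  induction p using Polynomial.induction_on generalizing u v with
  | C a => simp [aeval_C, Module.algebraMap_end_apply]
  | add p q hp hq => simp [hp, hq]
  | monomial n a ih =>
    have h1 : aeval H ((C a * X ^ (n + 1)).comp (-X)) v
        = -H (aeval H ((C a * X ^ n).comp (-X)) v) := by
      have : (C a * X ^ (n + 1)).comp (-X) = -(X * (C a * X ^ n).comp (-X)) := by
        simp; ring
      rw [this, map_neg, map_mul, aeval_X, LinearMap.neg_apply, Module.End.mul_apply]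
    rw [h1, map_neg, ← hω, ← ih, pow_succ, ← mul_assoc, map_mul _ _ X, aeval_X,
      Module.End.mul_apply]

open Polynomial in
/-- For a skew operator `H`, the kernel of `p(H)` is isotropic when `p(X)` and `p(-X)` are
coprime. -/
theorem bilin_eq_zero_of_mem_ker_aeval {K V : Type*} [Field K] [AddCommGroup V] [Module K V]
    (ω : V →ₗ[K] V →ₗ[K] K) (H : Module.End K V) (hω : ∀ u v, ω (H u) v = -ω u (H v))
    {p : K[X]} (hp : IsCoprime p (p.comp (-X))) {u v : V}
    (hu : u ∈ LinearMap.ker (aeval H p)) (hv : v ∈ LinearMap.ker (aeval H p)) : ω u v = 0 := by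
  obtain ⟨a, b, hab⟩ := hp
  have hv' : v = aeval H (p.comp (-X)) (aeval H b v) := by
    have := congrArg (fun q => aeval H q v) hab
    simp only [map_add, map_mul, LinearMap.add_apply, Module.End.mul_apply, map_one,
      Module.End.one_apply, LinearMap.mem_ker.1 hv, map_zero, zero_add] at this
    rw [← Module.End.mul_apply, ← map_mul, mul_comm, map_mul, Module.End.mul_apply, this]
  rw [hv', ← bilin_aeval_apply ω H hω, LinearMap.mem_ker.1 hu]
  simp

section Hamiltonian

variable {ι : Type*} [Fintype ι]

/-- The standard symplectic form. -/
noncomputable def symplecticForm (ι : Type*) [Fintype ι] :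
    (ι ⊕ ι → ℝ) →ₗ[ℝ] (ι ⊕ ι → ℝ) →ₗ[ℝ] ℝ :=
  LinearMap.mk₂ ℝ (fun u v => (u ∘ Sum.inl) ⬝ᵥ (v ∘ Sum.inr) - (u ∘ Sum.inr) ⬝ᵥ (v ∘ Sum.inl))
    (fun u u' v => by
      change (u ∘ Sum.inl + u' ∘ Sum.inl) ⬝ᵥ _ - (u ∘ Sum.inr + u' ∘ Sum.inr) ⬝ᵥ _ = _
      simp only [add_dotProduct]; ring)
    (fun c u v => by
      change (c • (u ∘ Sum.inl)) ⬝ᵥ _ - (c • (u ∘ Sum.inr)) ⬝ᵥ _ = _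
      simp only [smul_dotProduct, smul_sub])
    (fun u v v' => by
      change _ ⬝ᵥ (v ∘ Sum.inr + v' ∘ Sum.inr) - _ ⬝ᵥ (v ∘ Sum.inl + v' ∘ Sum.inl) = _
      simp only [dotProduct_add]; ring)
    (fun c u v => by
      change _ ⬝ᵥ (c • (v ∘ Sum.inr)) - _ ⬝ᵥ (c • (v ∘ Sum.inl)) = _
      simp only [dotProduct_smul, smul_sub])

/-- The Hamiltonian matrix of the Riccati equation `P A + Aᵀ P + P R P + Q = 0`. -/
def hamiltonian {R : Type*} [Ring R] (A S Q : Matrix ι ι R) : Matrix (ι ⊕ ι) (ι ⊕ ι) R :=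
  fromBlocks A S (-Q) (-Aᵀ)

theorem hamiltonian_mulVec_inl {R : Type*} [Ring R] (A S Q : Matrix ι ι R) (u : ι ⊕ ι → R) :
    (hamiltonian A S Q *ᵥ u) ∘ Sum.inl = A *ᵥ (u ∘ Sum.inl) + S *ᵥ (u ∘ Sum.inr) := by
  simp [hamiltonian, fromBlocks_mulVec]

theorem hamiltonian_mulVec_inr {R : Type*} [Ring R] (A S Q : Matrix ι ι R) (u : ι ⊕ ι → R) :
    (hamiltonian A S Q *ᵥ u) ∘ Sum.inr = -(Q *ᵥ (u ∘ Sum.inl)) - Aᵀ *ᵥ (u ∘ Sum.inr) := by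
  simp [hamiltonian, fromBlocks_mulVec, neg_mulVec, sub_eq_add_neg]

variable [DecidableEq ι]

theorem symplecticForm_hamiltonian {A S Q : Matrix ι ι ℝ} (hS : Sᵀ = S) (hQ : Qᵀ = Q)
    (u v : ι ⊕ ι → ℝ) :
    symplecticForm ι (toLin' (hamiltonian A S Q) u) v
      = -symplecticForm ι u (toLin' (hamiltonian A S Q) v) := by
  simp only [symplecticForm, LinearMap.mk₂_apply, toLin'_apply, hamiltonian_mulVec_inl,
    hamiltonian_mulVec_inr, add_dotProduct, sub_dotProduct, neg_dotProduct, dotProduct_add,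
    dotProduct_sub, dotProduct_neg]
  have t (M : Matrix ι ι ℝ) (x y : ι → ℝ) : (M *ᵥ x) ⬝ᵥ y = x ⬝ᵥ (Mᵀ *ᵥ y) := by
    rw [dotProduct_mulVec, vecMul_transpose]
  rw [t A, t S, t Q, t Aᵀ, hS, hQ, transpose_transpose]
  ring

open Polynomial in
/-- A Hamiltonian matrix without purely imaginary eigenvalues whose quadratic terms are
definite enough yields a symmetric solution of the Riccati equation. -/
theorem exists_riccati_solution_of_hamiltonian {A S Q : Matrix ι ι ℝ} (hS : Sᵀ = S) (hQ : Qᵀ = Q)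
    (hS0 : ∀ y, y ⬝ᵥ (S *ᵥ y) = 0 → S *ᵥ y = 0) (hQ0 : ∀ x, x ⬝ᵥ (Q *ᵥ x) = 0 → x = 0)
    (hA : IsHurwitz A)
    (hH : ∀ z ∈ spectrum ℂ ((hamiltonian A S Q).map (algebraMap ℝ ℂ)), z.re ≠ 0) :
    ∃ P : Matrix ι ι ℝ, Pᵀ = P ∧ P * A + Aᵀ * P + P * S * P + Q = 0 := by
  set H : Module.End ℝ (ι ⊕ ι → ℝ) := toLin' (hamiltonian A S Q) with hHdef
  have hω := symplecticForm_hamiltonian (A := A) hS hQ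
  rw [← hHdef] at hω
  obtain ⟨p, q, hpq, hp, hq⟩ := exists_eq_mul_of_forall_root_re_ne_zero
    (hamiltonian A S Q).charpoly (charpoly_monic _).ne_zero
    fun z hz => hH z ((aeval_charpoly_eq_zero_iff _ z).1 hz)
  set V := LinearMap.ker (aeval H p) with hV
  set W := LinearMap.ker (aeval H q) with hW
  have hcop : IsCoprime p q := isCoprime_of_root_re_neg_of_root_re_pos hp hq
  have hVW : V ⊔ W = ⊤ := by
    rw [hV, hW, sup_ker_aeval_eq_ker_aeval_mul_of_coprime H hcop, ← hpq, hHdef,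
      aeval_toLin'_charpoly, LinearMap.ker_zero]
  have hVi : ∀ u ∈ V, ∀ v ∈ V, symplecticForm ι u v = 0 := fun u hu v hv =>
    bilin_eq_zero_of_mem_ker_aeval _ H hω
      (isCoprime_of_root_re_neg_of_root_re_pos hp (root_comp_neg_X_re_pos hp)) hu hv
  have hWi : ∀ u ∈ W, ∀ v ∈ W, symplecticForm ι u v = 0 := fun u hu v hv =>
    bilin_eq_zero_of_mem_ker_aeval _ H hω
      (isCoprime_of_root_re_neg_of_root_re_pos (root_comp_neg_X_re_neg hq) hq).symm hu hv
  have hinv (r : ℝ[X]) : ∀ u ∈ LinearMap.ker (aeval H r), H u ∈ LinearMap.ker (aeval H r) := by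
    intro u hu
    rw [LinearMap.mem_ker] at hu ⊢
    have := congrArg (fun s => aeval H s u) (mul_comm r X)
    simpa [hu] using this
  let fst : (ι ⊕ ι → ℝ) →ₗ[ℝ] (ι → ℝ) := LinearMap.funLeft ℝ ℝ Sum.inl
  let snd : (ι ⊕ ι → ℝ) →ₗ[ℝ] (ι → ℝ) := LinearMap.funLeft ℝ ℝ Sum.inr
  have hext (u : ι ⊕ ι → ℝ) (h1 : fst u = 0) (h2 : snd u = 0) : u = 0 := by
    funext i
    rcases i with i | i
    · exact congrFun h1 i
    · exact congrFun h2 i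
  have hform (u v : ι ⊕ ι → ℝ) :
      symplecticForm ι u v = fst u ⬝ᵥ snd v - snd u ⬝ᵥ fst v := rfl
  have hH1 (u : ι ⊕ ι → ℝ) : fst (H u) = A *ᵥ fst u + S *ᵥ snd u :=
    hamiltonian_mulVec_inl A S Q u
  have hH2 (u : ι ⊕ ι → ℝ) : snd (H u) = -(Q *ᵥ fst u) - Aᵀ *ᵥ snd u :=
    hamiltonian_mulVec_inr A S Q u
  have hWinj : ∀ u ∈ W, snd u = 0 → u = 0 := by
    intro u hu h2
    have h := hWi u hu (H u) (hinv q u hu)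
    rw [hform, hH1, hH2, h2] at h
    simp only [mulVec_zero, sub_zero, dotProduct_neg, zero_dotProduct, neg_eq_zero] at h
    exact hext u (hQ0 _ h) h2
  have hVinj : ∀ u ∈ V, fst u = 0 → u = 0 := by
    -- On the kernel of `fst` in `V` the operator `-H` acts as `Aᵀ` on second components.
    have hK : ∀ u ∈ V ⊓ LinearMap.ker fst,
        (-H) u ∈ V ⊓ LinearMap.ker fst ∧ Aᵀ *ᵥ snd u = snd ((-H) u) := by
      intro u hu'
      obtain ⟨hu, h1⟩ := Submodule.mem_inf.1 hu'
      rw [LinearMap.mem_ker] at h1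
      have h := hVi u hu (H u) (hinv p u hu)
      rw [hform, hH1, hH2, h1] at h
      simp only [mulVec_zero, zero_add, zero_dotProduct, zero_sub, neg_eq_zero] at h
      have hSu := hS0 _ h
      refine ⟨Submodule.mem_inf.2 ⟨?_, ?_⟩, ?_⟩
      · rw [LinearMap.neg_apply]
        exact V.neg_mem (hinv p u hu)
      · rw [LinearMap.mem_ker, LinearMap.neg_apply, map_neg, hH1, h1, hSu]
        simp
      · rw [LinearMap.neg_apply, map_neg, hH2, h1]
        simp
    intro u hu h1
    refine hext u h1 ?_
    have hcop' : IsCoprime A.charpoly (p.comp (-X)) :=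
      isCoprime_of_root_re_neg_of_root_re_pos
        (fun z hz => hA z ((aeval_charpoly_eq_zero_iff _ z).1 hz)) (root_comp_neg_X_re_pos hp)
    have hpu : aeval (toLin' Aᵀ) (p.comp (-X)) (snd u) = 0 := by
      rw [aeval_apply_eq_of_intertwines (f := toLin' Aᵀ) (g := -H) snd (V ⊓ LinearMap.ker fst)
        (fun v hv => (hK v hv).1) (fun v hv => (hK v hv).2) _ u ⟨hu, h1⟩, aeval_comp]
      have : aeval (-H) (-X : ℝ[X]) = H := by simp
      rw [this, LinearMap.mem_ker.1 hu, map_zero]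
    obtain ⟨a, b, hab⟩ := hcop'
    have := congrArg (fun r => aeval (toLin' Aᵀ) r (snd u)) hab
    simp only [map_add, map_mul, LinearMap.add_apply, Module.End.mul_apply, hpu, map_zero,
      ← charpoly_transpose A, aeval_toLin'_charpoly, LinearMap.zero_apply, add_zero, map_one,
      Module.End.one_apply] at this
    exact this.symm
  have hWdim : Module.finrank ℝ W ≤ Fintype.card ι := by
    have hi : Function.Injective (snd ∘ₗ W.subtype) := by
      rw [← LinearMap.ker_eq_bot, LinearMap.ker_eq_bot']
      exact fun u hu => Subtype.ext (hWinj u u.2 hu)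
    simpa using LinearMap.finrank_le_finrank_of_injective hi
  have hi : Function.Injective (fst ∘ₗ V.subtype) := by
    rw [← LinearMap.ker_eq_bot, LinearMap.ker_eq_bot']
    exact fun u hu => Subtype.ext (hVinj u u.2 hu)
  have hVdim : Module.finrank ℝ V = Module.finrank ℝ (ι → ℝ) := by
    have h1 : Module.finrank ℝ V ≤ Fintype.card ι := by
      simpa using LinearMap.finrank_le_finrank_of_injective hi
    have h2 := Submodule.finrank_add_le_finrank_add_finrank V W
    rw [hVW, finrank_top] at h2
    simp only [Module.finrank_fintype_fun_eq_card, Fintype.card_sum] at h2 ⊢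
    omega
  let e : V ≃ₗ[ℝ] (ι → ℝ) := LinearEquiv.ofInjectiveOfFinrankEq _ hi hVdim
  have he (x : ι → ℝ) : fst (e.symm x) = x := e.apply_symm_apply x
  let P : Matrix ι ι ℝ := LinearMap.toMatrix' (snd ∘ₗ V.subtype ∘ₗ e.symm.toLinearMap)
  have hP (x : ι → ℝ) : P *ᵥ x = snd (e.symm x) := LinearMap.toMatrix'_mulVec _ _
  have hgraph : ∀ u ∈ V, snd u = P *ᵥ fst u := by
    intro u hu
    have : e.symm (fst u) = ⟨u, hu⟩ := by
      rw [LinearEquiv.symm_apply_eq]; rfl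
    rw [hP, this]
  refine ⟨P, ?_, ?_⟩
  · refine Matrix.ext_of_mulVec_single fun i => ?_
    refine dotProduct_eq _ _ fun x => ?_
    generalize (Pi.single i 1 : ι → ℝ) = y
    have h := hVi _ (e.symm x).2 _ (e.symm y).2
    rw [hform, ← hP, ← hP, he, he, sub_eq_zero] at h
    rw [dotProduct_comm, dotProduct_comm _ x, dotProduct_mulVec, vecMul_transpose, h]
  · refine Matrix.ext_of_mulVec_single fun i => ?_
    generalize (Pi.single i 1 : ι → ℝ) = x
    have h := hgraph _ (hinv p _ (e.symm x).2)
    rw [hH1, hH2, ← hP, he] at h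
    simp only [add_mulVec, ← mulVec_mulVec, zero_mulVec]
    rw [mulVec_add] at h
    rw [← sub_eq_zero] at h
    rw [← neg_eq_zero, ← h]
    abel

end Hamiltonian

theorem mem_spectrum_iff_exists_mulVec_eq_smul {ι : Type*} [Fintype ι] [DecidableEq ι]
    (M : Matrix ι ι ℂ) (z : ℂ) : z ∈ spectrum ℂ M ↔ ∃ v ≠ 0, M *ᵥ v = z • v := by
  rw [spectrum.mem_iff, Matrix.isUnit_iff_isUnit_det, isUnit_iff_ne_zero, not_not,
    ← Matrix.exists_mulVec_eq_zero_iff]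
  refine exists_congr fun v => and_congr_right fun _ => ?_
  rw [Algebra.algebraMap_eq_smul_one, sub_mulVec, smul_mulVec, one_mulVec, sub_eq_zero, eq_comm]

open Filter Topology in
theorem tendsto_pow_nhds_zero_of_spectralRadius_lt_one {𝓐 : Type*} [NormedRing 𝓐]
    [NormedAlgebra ℂ 𝓐] [CompleteSpace 𝓐] (a : 𝓐) (ha : spectralRadius ℂ a < 1) :
    Tendsto (fun k : ℕ => a ^ k) atTop (𝓝 0) := by
  obtain ⟨r, hr1, hr2⟩ := ENNReal.lt_iff_exists_nnreal_btwn.1 ha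
  have h := (spectrum.pow_nnnorm_pow_one_div_tendsto_nhds_spectralRadius a).eventually_lt_const hr1
  rw [tendsto_zero_iff_norm_tendsto_zero]
  have hr3 : (r : ℝ) < 1 := by exact_mod_cast hr2
  refine squeeze_zero' (Eventually.of_forall fun _ => norm_nonneg _) ?_
    (tendsto_pow_atTop_nhds_zero_of_lt_one r.2 hr3)
  filter_upwards [h, eventually_gt_atTop 0] with k hk hk0
  have h1 := ENNReal.rpow_le_rpow hk.le (Nat.cast_nonneg k)
  rw [← ENNReal.rpow_mul, one_div, inv_mul_cancel₀ (by positivity), ENNReal.rpow_one,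
    ENNReal.rpow_natCast] at h1
  exact_mod_cast h1

open Filter Topology in
theorem tendsto_pow_mulVec_of_forall_norm_lt_one {ι : Type*} [Fintype ι] [DecidableEq ι]
    (C : Matrix ι ι ℝ) (hC : ∀ z ∈ spectrum ℂ (C.map (algebraMap ℝ ℂ)), ‖z‖ < 1) (x : ι → ℝ) :
    Tendsto (fun k : ℕ => C ^ k *ᵥ x) atTop (𝓝 0) := by
  rcases isEmpty_or_nonempty ι with hι | hι
  · exact (tendsto_const_nhds (x := (0 : ι → ℝ))).congr fun k => Subsingleton.elim _ _
  let _ := Matrix.linftyOpNormedRing (n := ι) (α := ℂ)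
  let _ := Matrix.linftyOpNormedAlgebra (n := ι) (R := ℂ) (α := ℂ)
  have hrad : spectralRadius ℂ (C.map (algebraMap ℝ ℂ)) < (1 : NNReal) :=
    spectrum.spectralRadius_lt_of_forall_lt _ fun z hz => by exact_mod_cast hC z hz
  have h := tendsto_pow_nhds_zero_of_spectralRadius_lt_one _ (by rwa [ENNReal.coe_one] at hrad)
  have hC' : Tendsto (fun k : ℕ => C ^ k) atTop (𝓝 0) := by
    have hre : Continuous fun M : Matrix ι ι ℂ => M.map Complex.re :=
      continuous_id.matrix_map Complex.continuous_re
    have h1 := (hre.tendsto 0).comp h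
    have h0 : (0 : Matrix ι ι ℂ).map Complex.re = 0 := by ext; simp
    rw [h0] at h1
    refine h1.congr fun k => ?_
    have : C.map (algebraMap ℝ ℂ) ^ k = (C ^ k).map (algebraMap ℝ ℂ) :=
      (map_pow (algebraMap ℝ ℂ).mapMatrix C k).symm
    rw [Function.comp_apply, this]
    ext i j
    rfl
  have hmul : Continuous fun M : Matrix ι ι ℝ => M *ᵥ x :=
    continuous_id.matrix_mulVec continuous_const
  simpa [Function.comp_def] using (hmul.tendsto 0).comp hC'

open Filter Topology in
/-- Lyapunov's theorem: if `A` is Hurwitz, `P` is symmetric and `P A + Aᵀ P` is negative definite,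
then `P` is positive definite. -/
theorem IsHurwitz.posDef_of_lyapunov {ι : Type*} [Fintype ι] [DecidableEq ι]
    {A P : Matrix ι ι ℝ} (hA : IsHurwitz A) (hP : Pᵀ = P)
    (hneg : ∀ x ≠ 0, x ⬝ᵥ ((P * A + Aᵀ * P) *ᵥ x) < 0) : P.PosDef := by
  set Ac := A.map (algebraMap ℝ ℂ) with hAc
  have hD : IsUnit (1 - A).det := by
    rw [isUnit_iff_ne_zero]
    intro h0
    have h1 : ((1 - A).map (algebraMap ℝ ℂ)).det = 0 := by
      have := (RingHom.map_det (algebraMap ℝ ℂ) (1 - A)).symm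
      rw [h0, map_zero] at this
      exact this
    have h2 : (1 : ℂ) ∈ spectrum ℂ Ac := by
      rw [spectrum.mem_iff, Matrix.isUnit_iff_isUnit_det, isUnit_iff_ne_zero, not_not, map_one]
      rwa [Matrix.map_sub _ (by simp), Matrix.map_one _ (by simp) (by simp)] at h1
    have := hA 1 h2
    norm_num at this
  -- The Cayley transform of `A` is a strict contraction for the quadratic form of `P`.
  set C := (1 + A) * (1 - A)⁻¹ with hC
  have hCD : C * (1 - A) = 1 + A := by
    rw [hC, Matrix.mul_assoc, Matrix.nonsing_inv_mul _ hD, Matrix.mul_one]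
  have hCspec : ∀ z ∈ spectrum ℂ (C.map (algebraMap ℝ ℂ)), ‖z‖ < 1 := by
    intro z hz
    obtain ⟨v, hv0, hv⟩ := (mem_spectrum_iff_exists_mulVec_eq_smul _ z).1 hz
    have hDD : (1 - Ac) * ((1 - A)⁻¹).map (algebraMap ℝ ℂ) = 1 := by
      have := congrArg (fun M => M.map (algebraMap ℝ ℂ)) (Matrix.mul_nonsing_inv _ hD)
      rwa [Matrix.map_mul, Matrix.map_sub _ (by simp), Matrix.map_one _ (by simp) (by simp)]
        at this
    have hCDc : C.map (algebraMap ℝ ℂ) * (1 - Ac) = 1 + Ac := by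
      have := congrArg (fun M => M.map (algebraMap ℝ ℂ)) hCD
      rwa [Matrix.map_mul, Matrix.map_sub _ (by simp), Matrix.map_add _ (by simp),
        Matrix.map_one _ (by simp) (by simp)] at this
    obtain ⟨w, rfl⟩ : ∃ w, v = (1 - Ac) *ᵥ w :=
      ⟨((1 - A)⁻¹).map (algebraMap ℝ ℂ) *ᵥ v, by rw [mulVec_mulVec, hDD, one_mulVec]⟩
    have hw0 : w ≠ 0 := by
      rintro rfl
      simp at hv0
    rw [mulVec_mulVec, hCDc, add_mulVec, sub_mulVec, one_mulVec] at hv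
    have hv2 : (z + 1) • (Ac *ᵥ w) = (z - 1) • w := by
      rw [smul_sub] at hv
      rw [add_smul, sub_smul, one_smul, one_smul]
      linear_combination hv
    have hz1 : z + 1 ≠ 0 := by
      intro h
      rw [h, zero_smul, eq_comm, smul_eq_zero] at hv2
      rcases hv2 with h2 | h2
      · have : (2 : ℂ) = 0 := by linear_combination h - h2
        norm_num at this
      · exact hw0 h2
    have hmem : (z - 1) / (z + 1) ∈ spectrum ℂ Ac := by
      rw [mem_spectrum_iff_exists_mulVec_eq_smul]
      refine ⟨w, hw0, ?_⟩
      rw [div_eq_inv_mul, mul_smul, ← hv2, smul_smul, inv_mul_cancel₀ hz1, one_smul]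
    have hre := hA _ hmem
    have hns : 0 < Complex.normSq (z + 1) := Complex.normSq_pos.2 hz1
    rw [Complex.div_re, ← add_div, div_lt_iff₀ hns, zero_mul] at hre
    have h2 : ‖z‖ ^ 2 < 1 := by
      rw [← Complex.normSq_eq_norm_sq, Complex.normSq_apply]
      simp only [Complex.sub_re, Complex.add_re, Complex.sub_im, Complex.add_im, Complex.one_re,
        Complex.one_im, add_zero, sub_zero] at hre
      nlinarith
    nlinarith [norm_nonneg z]
  have hdec (x : ι → ℝ) (hx : x ≠ 0) : (C *ᵥ x) ⬝ᵥ (P *ᵥ (C *ᵥ x)) < x ⬝ᵥ (P *ᵥ x) := by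
    obtain ⟨y, rfl⟩ : ∃ y, x = (1 - A) *ᵥ y :=
      ⟨(1 - A)⁻¹ *ᵥ x, by rw [mulVec_mulVec, Matrix.mul_nonsing_inv _ hD, one_mulVec]⟩
    have hy0 : y ≠ 0 := by
      rintro rfl
      simp at hx
    have h := hneg y hy0
    rw [mulVec_mulVec, hCD, add_mulVec, sub_mulVec, one_mulVec]
    rw [add_mulVec, ← mulVec_mulVec, ← mulVec_mulVec, dotProduct_add, dotProduct_mulVec y Aᵀ,
      vecMul_transpose] at h
    simp only [mulVec_add, mulVec_sub, dotProduct_add, dotProduct_sub, add_dotProduct,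
      sub_dotProduct]
    linarith
  have hle (x : ι → ℝ) : (C *ᵥ x) ⬝ᵥ (P *ᵥ (C *ᵥ x)) ≤ x ⬝ᵥ (P *ᵥ x) := by
    by_cases hx : x = 0
    · simp [hx]
    · exact (hdec x hx).le
  have hnonneg (x : ι → ℝ) : 0 ≤ x ⬝ᵥ (P *ᵥ x) := by
    have hanti : Antitone fun k : ℕ => (C ^ k *ᵥ x) ⬝ᵥ (P *ᵥ (C ^ k *ᵥ x)) := by
      refine antitone_nat_of_succ_le fun k => ?_
      rw [pow_succ', ← mulVec_mulVec]
      exact hle _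
    have hcont : Continuous fun y : ι → ℝ => y ⬝ᵥ (P *ᵥ y) :=
      continuous_id.dotProduct (continuous_const.matrix_mulVec continuous_id)
    have hlim := (hcont.tendsto 0).comp (tendsto_pow_mulVec_of_forall_norm_lt_one C hCspec x)
    simp only [zero_dotProduct] at hlim
    simpa using hanti.le_of_tendsto hlim 0
  refine Matrix.PosDef.of_dotProduct_mulVec_pos (by simpa [IsHermitian] using hP) fun x hx => ?_
  simpa using (hnonneg _).trans_lt (hdec x hx)

theorem IsHurwitz.notMem_spectrum {ι : Type*} [Fintype ι] [DecidableEq ι] {A : Matrix ι ι ℝ}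
    (hA : IsHurwitz A) {z : ℂ} (hz : z.re = 0) :
    z ∉ spectrum ℂ (A.map (algebraMap ℝ ℂ)) :=
  fun h => (hA z h).ne hz

open Filter Topology Bornology Matrix.Norms.L2Operator in
theorem IsHurwitz.bddAbove_specNorm {ι κ : Type*} [Fintype ι] [DecidableEq ι] [Fintype κ]
    [DecidableEq κ] {A : Matrix ι ι ℝ} (hA : IsHurwitz A) (B : Matrix ι κ ℂ) :
    BddAbove (Set.range fun ω : ℝ => specNorm
      ((((ω : ℂ) * Complex.I) • (1 : Matrix ι ι ℂ) - A.map (algebraMap ℝ ℂ))⁻¹ * B)) := by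
  set Ac := A.map (algebraMap ℝ ℂ) with hAc
  have hres (ω : ℝ) : (((ω : ℂ) * Complex.I) • (1 : Matrix ι ι ℂ) - Ac)⁻¹
      = resolvent Ac ((ω : ℂ) * Complex.I) := by
    rw [resolvent, Algebra.algebraMap_eq_smul_one, nonsing_inv_eq_ringInverse]
  have hcont : Continuous fun ω : ℝ => resolvent Ac ((ω : ℂ) * Complex.I) := by
    refine continuous_iff_continuousAt.2 fun ω => ?_
    obtain ⟨u, hu⟩ : IsUnit (algebraMap ℂ (Matrix ι ι ℂ) ((ω : ℂ) * Complex.I) - Ac) :=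
      spectrum.notMem_iff.1 (hA.notMem_spectrum (by simp))
    have h1 := NormedRing.inverse_continuousAt u
    rw [hu] at h1
    have h2 : Continuous fun ω : ℝ =>
        algebraMap ℂ (Matrix ι ι ℂ) ((ω : ℂ) * Complex.I) - Ac := by
      simp only [Algebra.algebraMap_eq_smul_one]
      fun_prop
    exact ContinuousAt.comp (f := fun ω : ℝ =>
      algebraMap ℂ (Matrix ι ι ℂ) ((ω : ℂ) * Complex.I) - Ac) h1 h2.continuousAt
  have hlim : Tendsto (fun ω : ℝ => resolvent Ac ((ω : ℂ) * Complex.I)) (cocompact ℝ) (𝓝 0) := by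
    refine (spectrum.resolvent_tendsto_cobounded (𝕜 := ℂ) Ac).comp ?_
    rw [← tendsto_norm_atTop_iff_cobounded]
    simpa only [norm_mul, Complex.norm_real, Complex.norm_I, mul_one] using
      tendsto_norm_cocompact_atTop (E := ℝ)
  have hev : ∀ᶠ ω : ℝ in cocompact ℝ, ‖resolvent Ac ((ω : ℂ) * Complex.I)‖ < 1 :=
    hlim.norm.eventually_lt_const (by simp)
  obtain ⟨K, hK, hKs⟩ := mem_cocompact.1 hev
  obtain ⟨c, hc⟩ := hK.bddAbove_image hcont.norm.continuousOn
  refine ⟨max c 1 * ‖B‖, ?_⟩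
  rintro _ ⟨ω, rfl⟩
  simp only [hres]
  refine (l2_opNorm_mul _ _).trans (mul_le_mul_of_nonneg_right ?_ (norm_nonneg _))
  by_cases hω : ω ∈ K
  · exact (hc ⟨ω, hω, rfl⟩).trans (le_max_left _ _)
  · exact (hKs hω).le.trans (le_max_right _ _)

theorem norm_toLp_mulVec_le_specNorm {ι κ : Type*} [Fintype ι] [Fintype κ] [DecidableEq κ]
    (M : Matrix ι κ ℂ) (u : κ → ℂ) :
    ‖WithLp.toLp 2 (M *ᵥ u)‖ ≤ specNorm M * ‖WithLp.toLp 2 u‖ :=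
  (LinearMap.toContinuousLinearMap (Matrix.toEuclideanLin M)).le_opNorm (WithLp.toLp 2 u)

theorem star_dotProduct_self_eq_norm_sq {ι : Type*} [Fintype ι] (u : ι → ℂ) :
    star u ⬝ᵥ u = ((‖WithLp.toLp 2 u‖ ^ 2 : ℝ) : ℂ) := by
  have h := inner_self_eq_norm_sq_to_K (𝕜 := ℂ) (WithLp.toLp 2 u)
  rw [EuclideanSpace.inner_eq_star_dotProduct] at h
  rw [dotProduct_comm]
  simpa using h

theorem hamiltonian_map {ι R R' : Type*} [Ring R] [Ring R'] (f : R →+* R') (A S Q : Matrix ι ι R) :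
    (hamiltonian A S Q).map f = hamiltonian (A.map f) (S.map f) (Q.map f) := by
  ext (i | i) (j | j) <;> simp [hamiltonian]

/-- If the transfer function `(sI - A)⁻¹ B` has norm less than `1 / γ` on the imaginary axis, then
the associated Hamiltonian matrix has no eigenvalue there. -/
theorem hamiltonian_re_ne_zero_of_specNorm_lt {ι κ : Type*} [Fintype ι] [DecidableEq ι] [Fintype κ]
    [DecidableEq κ] {A : Matrix ι ι ℝ} {B : Matrix ι κ ℝ} {γ : ℝ} (hγ : 0 < γ) (hA : IsHurwitz A)
    (hG : ∀ ω : ℝ, specNorm ((((ω : ℂ) * Complex.I) • (1 : Matrix ι ι ℂ)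
      - A.map (algebraMap ℝ ℂ))⁻¹ * B.map (algebraMap ℝ ℂ)) < 1 / γ) (z : ℂ)
    (hz : z ∈ spectrum ℂ ((hamiltonian A (B * Bᵀ) ((γ ^ 2) • 1)).map (algebraMap ℝ ℂ))) :
    z.re ≠ 0 := by
  intro hre
  obtain ⟨w, hw0, hw⟩ := (mem_spectrum_iff_exists_mulVec_eq_smul _ z).1 hz
  obtain ⟨ω, rfl⟩ : ∃ ω : ℝ, z = (ω : ℂ) * Complex.I := ⟨z.im, by
    conv_lhs => rw [← Complex.re_add_im z, hre, Complex.ofReal_zero, zero_add]⟩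
  set Ac := A.map (algebraMap ℝ ℂ) with hAc
  set Bc := B.map (algebraMap ℝ ℂ) with hBc
  have hAH : Acᴴ = Acᵀ := by ext; simp [hAc]
  have hBH : Bcᴴ = Bcᵀ := by ext; simp [hBc]
  set T := ((ω : ℂ) * Complex.I) • (1 : Matrix ι ι ℂ) - Ac with hT
  have hTu : IsUnit T.det := by
    rw [← Matrix.isUnit_iff_isUnit_det, hT, ← Algebra.algebraMap_eq_smul_one]
    exact spectrum.notMem_iff.1 (hA.notMem_spectrum (by simp))
  rw [hamiltonian_map] at hw
  have hQ : ((γ ^ 2) • (1 : Matrix ι ι ℝ)).map (algebraMap ℝ ℂ)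
      = ((γ : ℂ) ^ 2) • (1 : Matrix ι ι ℂ) := by
    ext i j
    by_cases h : i = j <;> simp [h]
  have hS : (B * Bᵀ).map (algebraMap ℝ ℂ) = Bc * Bcᴴ := by
    rw [hBH, Matrix.map_mul, Matrix.transpose_map]
  rw [hQ, hS] at hw
  have hw1 := congrArg (fun v => v ∘ Sum.inl) hw
  have hw2 := congrArg (fun v => v ∘ Sum.inr) hw
  simp only [hamiltonian_mulVec_inl, hamiltonian_mulVec_inr] at hw1 hw2
  set x := w ∘ Sum.inl with hx
  set y := w ∘ Sum.inr with hy
  change _ = ((ω : ℂ) * Complex.I) • x at hw1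
  change _ = ((ω : ℂ) * Complex.I) • y at hw2
  set u := Bcᴴ *ᵥ y with hu
  have h1 : T *ᵥ x = Bc *ᵥ u := by
    rw [hT, sub_mulVec, smul_mulVec, one_mulVec, ← hw1, hu, mulVec_mulVec, add_sub_cancel_left]
  have h2 : Tᴴ *ᵥ y = ((γ : ℂ) ^ 2) • x := by
    have : Tᴴ = -(((ω : ℂ) * Complex.I) • (1 : Matrix ι ι ℂ)) - Acᵀ := by
      rw [hT, conjTranspose_sub, conjTranspose_smul, hAH]
      simp
    rw [this, sub_mulVec, neg_mulVec, smul_mulVec, one_mulVec, ← hw2, smul_mulVec, one_mulVec]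
    abel
  have hxu : x = (T⁻¹ * Bc) *ᵥ u := by
    rw [← mulVec_mulVec, ← h1, mulVec_mulVec, nonsing_inv_mul _ hTu, one_mulVec]
  have hnorm : ‖WithLp.toLp 2 u‖ ^ 2 = γ ^ 2 * ‖WithLp.toLp 2 x‖ ^ 2 := by
    have h3 : star u ⬝ᵥ u = (γ : ℂ) ^ 2 * (star x ⬝ᵥ x) := by
      calc star u ⬝ᵥ u = star (Bc *ᵥ u) ⬝ᵥ y := by
            rw [star_mulVec Bc u, ← dotProduct_mulVec]
        _ = star x ⬝ᵥ (Tᴴ *ᵥ y) := by rw [← h1, star_mulVec, ← dotProduct_mulVec]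
        _ = (γ : ℂ) ^ 2 * (star x ⬝ᵥ x) := by rw [h2, dotProduct_smul, smul_eq_mul]
    rw [star_dotProduct_self_eq_norm_sq, star_dotProduct_self_eq_norm_sq] at h3
    exact_mod_cast h3
  have hnorm' : ‖WithLp.toLp 2 u‖ = γ * ‖WithLp.toLp 2 x‖ := by
    rw [← mul_pow] at hnorm
    exact (pow_left_inj₀ (norm_nonneg _) (by positivity) two_ne_zero).1 hnorm
  have hle := norm_toLp_mulVec_le_specNorm (T⁻¹ * Bc) u
  rw [← hxu] at hle
  have hu0 : u = 0 := by
    by_contra hne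
    have hpos : 0 < ‖WithLp.toLp 2 u‖ := by
      rw [norm_pos_iff]
      simpa using hne
    have h4 := mul_lt_mul_of_pos_right (hG ω) hpos
    have h5 := mul_lt_mul_of_pos_left (hle.trans_lt h4) hγ
    rw [← hnorm', ← mul_assoc, mul_one_div_cancel hγ.ne', one_mul] at h5
    exact lt_irrefl _ h5
  have hx0 : x = 0 := by rw [hxu, hu0, mulVec_zero]
  have hy0 : y = 0 := by
    rw [hx0, smul_zero] at h2
    have hTH : IsUnit (Tᴴ).det := by
      rw [det_conjTranspose]
      exact hTu.star
    have := congrArg (fun v => (Tᴴ)⁻¹ *ᵥ v) h2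
    simpa [mulVec_mulVec, nonsing_inv_mul _ hTH] using this
  refine hw0 (funext fun i => ?_)
  rcases i with i | i
  · exact congrFun hx0 i
  · exact congrFun hy0 i

theorem bounded_real_lemma_riccati_existence {n m : ℕ}
    (A : Matrix (Fin n) (Fin n) ℝ) (B : Matrix (Fin n) (Fin m) ℝ)
    (γ : ℝ) (hγ : 0 < γ) (hA : IsHurwitz A)
    (hG : hinfNorm (fun ω =>
      ((((ω : ℂ) * Complex.I) • (1 : Matrix (Fin n) (Fin n) ℂ)
          - A.map (algebraMap ℝ ℂ))⁻¹ * B.map (algebraMap ℝ ℂ))) < 1 / γ) :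
    ∃ X : Matrix (Fin n) (Fin n) ℝ, X.PosDef ∧
      A * X + X * Aᵀ + (γ ^ 2) • (X * X) + B * Bᵀ = 0 := by
  have hbound := fun ω : ℝ =>
    (le_ciSup (hA.bddAbove_specNorm (B.map (algebraMap ℝ ℂ))) ω).trans_lt hG
  have hBB (y : Fin n → ℝ) : y ⬝ᵥ ((B * Bᵀ) *ᵥ y) = (Bᵀ *ᵥ y) ⬝ᵥ (Bᵀ *ᵥ y) := by
    rw [← mulVec_mulVec, dotProduct_mulVec, ← mulVec_transpose]
  have hQ (x : Fin n → ℝ) : x ⬝ᵥ (((γ ^ 2) • (1 : Matrix (Fin n) (Fin n) ℝ)) *ᵥ x)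
      = γ ^ 2 * (x ⬝ᵥ x) := by
    rw [smul_mulVec, one_mulVec, dotProduct_smul, smul_eq_mul]
  have hself (x : Fin n → ℝ) (hx : x ≠ 0) : 0 < x ⬝ᵥ x :=
    lt_of_le_of_ne (Finset.sum_nonneg fun i _ => mul_self_nonneg (x i))
      fun h => hx (dotProduct_self_eq_zero.1 h.symm)
  obtain ⟨P, hPT, hP⟩ := exists_riccati_solution_of_hamiltonian (A := A) (S := B * Bᵀ)
    (Q := (γ ^ 2) • 1) (by simp) (by simp)
    (fun y hy => by
      rw [hBB, dotProduct_self_eq_zero] at hy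
      rw [← mulVec_mulVec, hy, mulVec_zero])
    (fun x hx => by
      rw [hQ] at hx
      exact dotProduct_self_eq_zero.1 ((mul_eq_zero.1 hx).resolve_left (by positivity)))
    hA (hamiltonian_re_ne_zero_of_specNorm_lt hγ hA hbound)
  have hPpos : P.PosDef := by
    refine hA.posDef_of_lyapunov hPT fun x hx => ?_
    have h1 : P * A + Aᵀ * P = -(P * (B * Bᵀ) * P + (γ ^ 2) • 1) := by
      rw [eq_neg_iff_add_eq_zero, ← hP]
      abel
    have h2 : x ⬝ᵥ ((P * (B * Bᵀ) * P) *ᵥ x) = (Bᵀ *ᵥ (P *ᵥ x)) ⬝ᵥ (Bᵀ *ᵥ (P *ᵥ x)) := by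
      rw [← hBB, ← mulVec_mulVec, ← mulVec_mulVec, dotProduct_mulVec x P, ← mulVec_transpose, hPT]
    rw [h1, neg_mulVec, add_mulVec, dotProduct_neg, dotProduct_add, h2, hQ]
    have h3 : 0 ≤ (Bᵀ *ᵥ (P *ᵥ x)) ⬝ᵥ (Bᵀ *ᵥ (P *ᵥ x)) :=
      Finset.sum_nonneg fun i _ => mul_self_nonneg _
    have h4 := mul_pos (pow_pos hγ 2) (hself x hx)
    linarith
  have hdet : IsUnit P.det := hPpos.det_pos.ne'.isUnit
  refine ⟨P⁻¹, hPpos.inv, ?_⟩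
  have h := congrArg (fun M => P⁻¹ * M * P⁻¹) hP
  simp only [Matrix.mul_add, Matrix.add_mul, Matrix.mul_zero, Matrix.zero_mul] at h
  have e1 : P⁻¹ * (P * A) * P⁻¹ = A * P⁻¹ := by
    rw [← Matrix.mul_assoc, nonsing_inv_mul _ hdet, Matrix.one_mul]
  have e2 : P⁻¹ * (Aᵀ * P) * P⁻¹ = P⁻¹ * Aᵀ := by
    rw [← Matrix.mul_assoc, Matrix.mul_assoc, mul_nonsing_inv _ hdet, Matrix.mul_one]
  have e3 : P⁻¹ * (P * (B * Bᵀ) * P) * P⁻¹ = B * Bᵀ := by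
    rw [Matrix.mul_assoc P, ← Matrix.mul_assoc P⁻¹, nonsing_inv_mul _ hdet, Matrix.one_mul,
      Matrix.mul_assoc, mul_nonsing_inv _ hdet, Matrix.mul_one]
  have e4 : P⁻¹ * ((γ ^ 2) • (1 : Matrix (Fin n) (Fin n) ℝ)) * P⁻¹ = (γ ^ 2) • (P⁻¹ * P⁻¹) := by
    rw [Matrix.mul_smul, Matrix.mul_one, Matrix.smul_mul]
  rw [e1, e2, e3, e4] at h
  rw [← h]
  abel
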